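/- arXiv:2603.29540 — 5 statements merged into one kernel-verified Lean document; each statement's English description precedes it below -/
import Mathlib

section
/- Let c, s be real numbers with c² + s² = 1. Let L₁ be the x-axis in ℝ³ and let L₂ be the line through (0,0,1) with direction vector (c,s,0). Then a point (x,y,z) ∈ ℝ³ is equidistant from L₁ and L₂ (i.e., the infimum distance from (x,y,z) to L₁ equals the infimum distance to L₂) if and only if F₁(x,y,z) = y² − (x·s − y·c)² + 2z − 1 = 0. -/
/-- The point `(x, y, z)` of Euclidean 3-space. -/
noncomputable def pt (x y z : ℝ) : EuclideanSpace ℝ (Fin 3) :=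
  (WithLp.equiv 2 (Fin 3 → ℝ)).symm ![x, y, z]

theorem dist_pt (x y z x' y' z' : ℝ) :
    dist (pt x y z) (pt x' y' z') = √((x - x') ^ 2 + (y - y') ^ 2 + (z - z') ^ 2) := by
  simp [pt, EuclideanSpace.dist_eq, Fin.sum_univ_three, Real.dist_eq, sq_abs]

/-- The distance from a point to the line through `(0, 0, h)` with unit direction `(c, s, 0)`. -/
theorem infDist_pt_horizontal_line {c s : ℝ} (hcs : c ^ 2 + s ^ 2 = 1) (h x y z : ℝ) :
    Metric.infDist (pt x y z) {p | ∃ t : ℝ, p = pt (t * c) (t * s) h} =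
      √((x * s - y * c) ^ 2 + (z - h) ^ 2) := by
  have dist_sq (t : ℝ) : (x - t * c) ^ 2 + (y - t * s) ^ 2 + (z - h) ^ 2 =
      (x * c + y * s - t) ^ 2 + ((x * s - y * c) ^ 2 + (z - h) ^ 2) := by
    linear_combination (t ^ 2 - x ^ 2 - y ^ 2) * hcs
  have mem (t : ℝ) : pt (t * c) (t * s) h ∈ {p | ∃ t : ℝ, p = pt (t * c) (t * s) h} := ⟨t, rfl⟩
  apply le_antisymm
  · refine (Metric.infDist_le_dist_of_mem (mem (x * c + y * s))).trans_eq ?_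
    rw [dist_pt, dist_sq, sub_self, zero_pow two_ne_zero, zero_add]
  · refine (Metric.le_infDist ⟨_, mem 0⟩).2 ?_
    rintro _ ⟨t, rfl⟩
    rw [dist_pt, dist_sq]
    exact Real.sqrt_le_sqrt (le_add_of_nonneg_left (sq_nonneg _))

/-- A point `(x,y,z)` is equidistant from the x-axis `L₁` and from the line `L₂`
through `(0,0,1)` with direction `(c,s,0)` (where `c² + s² = 1`) if and only if
`F₁(x,y,z) = y² − (x·s − y·c)² + 2z − 1 = 0`. -/
theorem line_line_bisector (c s : ℝ) (hcs : c ^ 2 + s ^ 2 = 1)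
    (L₁ L₂ : Set (EuclideanSpace ℝ (Fin 3)))
    (hL₁ : L₁ = {p | ∃ t : ℝ, p = pt t 0 0})
    (hL₂ : L₂ = {p | ∃ t : ℝ, p = pt (t * c) (t * s) 1})
    (x y z : ℝ) :
    Metric.infDist (pt x y z) L₁ = Metric.infDist (pt x y z) L₂ ↔
      y ^ 2 - (x * s - y * c) ^ 2 + 2 * z - 1 = 0 := by
  have hL₁' : L₁ = {p | ∃ t : ℝ, p = pt (t * 1) (t * 0) 0} := by simpa using hL₁
  rw [hL₁', hL₂, infDist_pt_horizontal_line (by norm_num), infDist_pt_horizontal_line hcs,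
    Real.sqrt_inj (by positivity) (by positivity)]
  constructor <;> intro h <;> linear_combination h
end

section
/- Let c, s, k, R be real numbers with c² + s² = 1, s ≠ 0, R > 0, k ≠ 0, and k ≠ 1. Consider the polynomial maps on ℝ⁵ (in variables (x,y,z,u,v)) given by F₁ = y² − (x·s − y·c)² + 2z − 1, G₂ = (x−u)² + (y−v)² + (z−k)² − (y² + z²), F₃ = u² + v² − R², F₄ = y·u − x·v, and let J be the 4×5 matrix of partial derivatives of (F₁, G₂, F₃, F₄) with respect to (x,y,z,u,v). Then there is no point (x,y,z,u,v) ∈ ℝ⁵ at which F₁ = G₂ = F₃ = F₄ = 0 and all five 4×4 minors of J vanish. (In particular, the lifted trisector system has no real affine singular point.) -/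
/-- The 4×5 Jacobian matrix of `(F₁, G₂, F₃, F₄)` with respect to `(x,y,z,u,v)`,
with entries given by the explicit partial derivatives:
`F₁ = y² − (x·s − y·c)² + 2z − 1`,
`G₂ = (x−u)² + (y−v)² + (z−k)² − (y² + z²)`,
`F₃ = u² + v² − R²`,
`F₄ = y·u − x·v`. -/
def liftedJacobian (c s k : ℝ) (x y z u v : ℝ) : Matrix (Fin 4) (Fin 5) ℝ :=
  !![-(2 * s * (x * s - y * c)), 2 * y + 2 * c * (x * s - y * c), 2, 0, 0;
     2 * (x - u), 2 * (y - v) - 2 * y, 2 * (z - k) - 2 * z, -(2 * (x - u)), -(2 * (y - v));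
     0, 0, 0, 2 * u, 2 * v;
     -v, u, 0, y, -x]

/-- For admissible parameters, the lifted line–line–circle trisector system has no real
affine singular point: there is no point of ℝ⁵ where `F₁ = G₂ = F₃ = F₄ = 0` and all five
4×4 minors of the Jacobian `J` vanish. -/
theorem no_affine_singularities (c s k R : ℝ)
    (hcs : c ^ 2 + s ^ 2 = 1) (hs : s ≠ 0) (hR : 0 < R) (hk0 : k ≠ 0) (hk1 : k ≠ 1) :
    ¬ ∃ x y z u v : ℝ,
      y ^ 2 - (x * s - y * c) ^ 2 + 2 * z - 1 = 0 ∧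
      (x - u) ^ 2 + (y - v) ^ 2 + (z - k) ^ 2 - (y ^ 2 + z ^ 2) = 0 ∧
      u ^ 2 + v ^ 2 - R ^ 2 = 0 ∧
      y * u - x * v = 0 ∧
      ∀ j : Fin 5,
        ((liftedJacobian c s k x y z u v).submatrix id j.succAbove).det = 0 := by
  rintro ⟨x, y, z, u, v, h1, h2, h3, h4, hJ⟩
  have hR2 : 0 < R ^ 2 := by positivity
  have huv : u ^ 2 + v ^ 2 ≠ 0 := by nlinarith
  -- The two planar vectors are parallel.
  obtain ⟨t, rfl, rfl⟩ : ∃ t : ℝ, x = t * u ∧ y = t * v := by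
    refine ⟨(x * u + y * v) / (u ^ 2 + v ^ 2), ?_, ?_⟩
    · field_simp
      linear_combination -v * h4
    · field_simp
      linear_combination u * h4
  have m0 := hJ 0
  have m1 := hJ 1
  have m3 := hJ 3
  have m4 := hJ 4
  simp [liftedJacobian, Matrix.det_succ_row_zero, Fin.sum_univ_succ, Fin.succAbove]
    at m0 m1 m3 m4
  -- `X` and `Y` are half the `x`- and `y`-derivatives of `k * F₁ + G₂`.
  obtain ⟨X, hX⟩ : ∃ X, X = t * u - u - k * s * (t * u * s - t * v * c) := ⟨_, rfl⟩
  obtain ⟨Y, hY⟩ : ∃ Y, Y = k * (t * v + c * (t * u * s - t * v * c)) - v := ⟨_, rfl⟩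
  have eY : t * (u ^ 2 + v ^ 2) * Y = 0 := by
    rw [hY]; linear_combination (1 / 8) * m0
  have eX : t * (u ^ 2 + v ^ 2) * X = 0 := by
    rw [hX]; linear_combination (1 / 8) * m1
  have e3 : v * (X * u + Y * v) = 0 := by
    rw [hX, hY]; linear_combination (-1 / 8) * m3
  have e4 : u * (X * u + Y * v) = 0 := by
    rw [hX, hY]; linear_combination (-1 / 8) * m4
  have eA : X * u + Y * v = 0 := by
    refine (mul_eq_zero.mp ?_).resolve_left huv
    linear_combination u * e4 + v * e3
  have ht : t ≠ 0 := by
    rintro rfl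
    apply huv
    rw [hX, hY] at eA
    linear_combination -eA
  have X0 : X = 0 := (mul_eq_zero.mp eX).resolve_left (mul_ne_zero ht huv)
  have Y0 : Y = 0 := (mul_eq_zero.mp eY).resolve_left (mul_ne_zero ht huv)
  rw [X0] at hX
  rw [Y0] at hY
  have hw : R ^ 2 * (t - 1) = k ^ 2 - k := by
    linear_combination -k * h1 - h2 - t * u * hX - t * v * hY - (t - 1) * h3
  -- `1 / t` is an eigenvalue of the quadratic form `k * (y² - (x s - y c)²) + x²`.
  have hP : t ^ 2 * k * s ^ 2 * (1 - k) - t + 1 = 0 := by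
    have hu : (t ^ 2 * k * s ^ 2 * (1 - k) - t + 1) * u = 0 := by
      linear_combination (-(t * k * s ^ 2 - 1)) * hX + t * k * s * c * hY
        + (t ^ 2 * k ^ 2 * s * (s * u - c * v)) * hcs
    have hv : (t ^ 2 * k * s ^ 2 * (1 - k) - t + 1) * v = 0 := by
      linear_combination t * k * s * c * hX - (t * (1 - k * s ^ 2) - 1) * hY
        + (t ^ 2 * k ^ 2 * s ^ 2 * v + (t * (1 - k * s ^ 2) - 1) * t * k * v) * hcs
    refine (mul_eq_zero.mp ?_).resolve_right huv
    linear_combination u * hu + v * hv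
  have hk : k ^ 2 - k ≠ 0 := by
    have := mul_ne_zero hk0 (sub_ne_zero.mpr hk1)
    contrapose! this
    linear_combination this
  have hfin : 1 + s ^ 2 * t ^ 2 * R ^ 2 = 0 := by
    refine (mul_eq_zero.mp ?_).resolve_left hk
    linear_combination -R ^ 2 * hP - hw
  nlinarith [sq_nonneg (s * t * R)]
end

section
/- Let c, s, R be real numbers with c² + s² = 1. Define F₁(x,y,z) = y² − (x·s − y·c)² + 2z − 1, F₂⁽¹⁾(x,y,z) = (x² − 2z + R² + 1)² − 4R²(x² + y²) (the line–circle bisector at k = 1), P₁(x,y) = (x·c + y·s)² − 2R(x·s − y·c) − R², and P₂(x,y) = (x·c + y·s)² + 2R(x·s − y·c) − R². Then for every (x,y,z) ∈ ℝ³ with F₁(x,y,z) = 0, one has F₂⁽¹⁾(x,y,z) = P₁(x,y)·P₂(x,y). Consequently, the k = 1 trisector {F₁ = 0, F₂⁽¹⁾ = 0} equals the union of the two curves {F₁ = 0, P₁ = 0} and {F₁ = 0, P₂ = 0}. -/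
/-- The line–line bisector polynomial `F₁`. -/
def F1p (c s x y z : ℝ) : ℝ := y ^ 2 - (x * s - y * c) ^ 2 + 2 * z - 1

/-- The line–circle bisector polynomial at the boundary value `k = 1`. -/
def F2k1 (R x y z : ℝ) : ℝ :=
  (x ^ 2 - 2 * z + R ^ 2 + 1) ^ 2 - 4 * R ^ 2 * (x ^ 2 + y ^ 2)

/-- The first quadratic cylinder factor at `k = 1`. -/
def P1 (c s R x y : ℝ) : ℝ := (x * c + y * s) ^ 2 - 2 * R * (x * s - y * c) - R ^ 2

/-- The second quadratic cylinder factor at `k = 1`. -/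
def P2 (c s R x y : ℝ) : ℝ := (x * c + y * s) ^ 2 + 2 * R * (x * s - y * c) - R ^ 2

/-- If `c² + s² = 1`, then on the line–line bisector `F₁ = 0` the `k = 1` line–circle
bisector factors as `F₂⁽¹⁾ = P₁·P₂`; consequently the `k = 1` trisector is the union of
the two curves `{F₁ = 0, P₁ = 0}` and `{F₁ = 0, P₂ = 0}`. -/
theorem k_eq_one_splitting (c s R : ℝ) (hcs : c ^ 2 + s ^ 2 = 1) :
    (∀ x y z : ℝ, F1p c s x y z = 0 →
      F2k1 R x y z = P1 c s R x y * P2 c s R x y) ∧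
    ({p : ℝ × ℝ × ℝ | F1p c s p.1 p.2.1 p.2.2 = 0 ∧ F2k1 R p.1 p.2.1 p.2.2 = 0} =
      {p : ℝ × ℝ × ℝ | F1p c s p.1 p.2.1 p.2.2 = 0 ∧ P1 c s R p.1 p.2.1 = 0} ∪
      {p : ℝ × ℝ × ℝ | F1p c s p.1 p.2.1 p.2.2 = 0 ∧ P2 c s R p.1 p.2.1 = 0}) := by
  have splitting : ∀ x y z : ℝ, F1p c s x y z = 0 →
      F2k1 R x y z = P1 c s R x y * P2 c s R x y := by
    intro x y z h
    unfold F1p at h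
    unfold F2k1 P1 P2
    have rotation : x ^ 2 + y ^ 2 = (x * c + y * s) ^ 2 + (x * s - y * c) ^ 2 := by
      linear_combination (-(x ^ 2 + y ^ 2)) * hcs
    have base : x ^ 2 - 2 * z + R ^ 2 + 1 = (x * c + y * s) ^ 2 + R ^ 2 := by
      linear_combination rotation - h
    rw [base, rotation]
    ring
  refine ⟨splitting, ?_⟩
  ext ⟨x, y, z⟩
  simp only [Set.mem_ofPred_eq, Set.mem_union, ← and_or_left]
  refine and_congr_right fun h => ?_
  rw [splitting x y z h, mul_eq_zero]
end

section
/- Let c, s, R be real numbers with c² + s² = 1 and R > 0, and let p₊ = (R·c, R·s, (1 − R²·s²)/2). Regard F₁(x,y,z) = y² − (x·s − y·c)² + 2z − 1, P₁(x,y,z) = (x·c + y·s)² − 2R(x·s − y·c) − R², and P₂(x,y,z) = (x·c + y·s)² + 2R(x·s − y·c) − R² as smooth functions on ℝ³. Then the gradients at p₊ are ∇F₁(p₊) = (0, 2Rs, 2), ∇P₁(p₊) = (2R(c − s), 2R(s + c), 0), ∇P₂(p₊) = (2R(c + s), 2R(s − c), 0), and the determinant of the 3×3 matrix whose rows are these three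 gradients equals −16R² ≠ 0. In particular, the two quartic components of the k = 1 trisector are smooth at p₊ and cross transversely there, so p₊ is an ordinary real node. -/
/-- The line–line bisector `F₁` as a function on `ℝ³ = ℝ × ℝ × ℝ`. -/
def F1f (c s : ℝ) : ℝ × ℝ × ℝ → ℝ :=
  fun p => p.2.1 ^ 2 - (p.1 * s - p.2.1 * c) ^ 2 + 2 * p.2.2 - 1

/-- The first quadratic cylinder factor at `k = 1`, as a function on `ℝ³`. -/
def P1f (c s R : ℝ) : ℝ × ℝ × ℝ → ℝ :=
  fun p => (p.1 * c + p.2.1 * s) ^ 2 - 2 * R * (p.1 * s - p.2.1 * c) - R ^ 2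

/-- The second quadratic cylinder factor at `k = 1`, as a function on `ℝ³`. -/
def P2f (c s R : ℝ) : ℝ × ℝ × ℝ → ℝ :=
  fun p => (p.1 * c + p.2.1 * s) ^ 2 + 2 * R * (p.1 * s - p.2.1 * c) - R ^ 2

theorem hasFDerivAt_fst_coord (p : ℝ × ℝ × ℝ) :
    HasFDerivAt (fun q : ℝ × ℝ × ℝ => q.1) (ContinuousLinearMap.fst ℝ ℝ (ℝ × ℝ)) p :=
  hasFDerivAt_fst

theorem hasFDerivAt_snd_coord (p : ℝ × ℝ × ℝ) :
    HasFDerivAt (fun q : ℝ × ℝ × ℝ => q.2.1)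
      ((ContinuousLinearMap.fst ℝ ℝ ℝ).comp (ContinuousLinearMap.snd ℝ ℝ (ℝ × ℝ))) p :=
  hasFDerivAt_snd.fst

theorem hasFDerivAt_thd_coord (p : ℝ × ℝ × ℝ) :
    HasFDerivAt (fun q : ℝ × ℝ × ℝ => q.2.2)
      ((ContinuousLinearMap.snd ℝ ℝ ℝ).comp (ContinuousLinearMap.snd ℝ ℝ (ℝ × ℝ))) p :=
  hasFDerivAt_snd.snd

theorem fderiv_F1f_apply (c s : ℝ) (p v : ℝ × ℝ × ℝ) :
    fderiv ℝ (F1f c s) p v =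
      2 * p.2.1 * v.2.1 - 2 * (p.1 * s - p.2.1 * c) * (v.1 * s - v.2.1 * c) + 2 * v.2.2 := by
  have hx := hasFDerivAt_fst_coord p
  have hy := hasFDerivAt_snd_coord p
  have hz := hasFDerivAt_thd_coord p
  have h : HasFDerivAt (F1f c s) _ p :=
    (((hy.pow 2).sub (((hx.mul_const s).sub (hy.mul_const c)).pow 2)).add
      (hz.const_mul 2)).sub_const 1
  rw [h.fderiv]
  simp [-add_left_inj, -sub_right_inj, -sub_left_inj, -mul_eq_mul_left_iff]
  ring

theorem fderiv_P1f_apply (c s R : ℝ) (p v : ℝ × ℝ × ℝ) :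
    fderiv ℝ (P1f c s R) p v =
      2 * (p.1 * c + p.2.1 * s) * (v.1 * c + v.2.1 * s) - 2 * R * (v.1 * s - v.2.1 * c) := by
  have hx := hasFDerivAt_fst_coord p
  have hy := hasFDerivAt_snd_coord p
  have h : HasFDerivAt (P1f c s R) _ p :=
    ((((hx.mul_const c).add (hy.mul_const s)).pow 2).sub
      (((hx.mul_const s).sub (hy.mul_const c)).const_mul (2 * R))).sub_const (R ^ 2)
  rw [h.fderiv]
  simp
  ring

/-- `P2f` is `P1f` with the sign of the radius reversed. -/
theorem P2f_eq_P1f_neg (c s R : ℝ) : P2f c s R = P1f c s (-R) := by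
  funext p
  simp only [P1f, P2f]
  ring

/-- At the point `pPlus = (Rc, Rs, (1 − R²s²)/2)` the gradients of `F₁, P₁, P₂` are
`(0, 2Rs, 2)`, `(2R(c−s), 2R(s+c), 0)`, `(2R(c+s), 2R(s−c), 0)` respectively, and the
determinant of the 3×3 matrix with these rows equals `−16R² ≠ 0`. In particular the two
quartic components of the `k = 1` trisector are smooth at `pPlus` and cross transversely
there, so `pPlus` is an ordinary real node. -/
theorem k_eq_one_node_transversality (c s R : ℝ) (hcs : c ^ 2 + s ^ 2 = 1) (hR : 0 < R)
    (pPlus : ℝ × ℝ × ℝ) (hp : pPlus = (R * c, R * s, (1 - R ^ 2 * s ^ 2) / 2)) :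
    fderiv ℝ (F1f c s) pPlus (1, 0, 0) = 0 ∧
    fderiv ℝ (F1f c s) pPlus (0, 1, 0) = 2 * R * s ∧
    fderiv ℝ (F1f c s) pPlus (0, 0, 1) = 2 ∧
    fderiv ℝ (P1f c s R) pPlus (1, 0, 0) = 2 * R * (c - s) ∧
    fderiv ℝ (P1f c s R) pPlus (0, 1, 0) = 2 * R * (s + c) ∧
    fderiv ℝ (P1f c s R) pPlus (0, 0, 1) = 0 ∧
    fderiv ℝ (P2f c s R) pPlus (1, 0, 0) = 2 * R * (c + s) ∧
    fderiv ℝ (P2f c s R) pPlus (0, 1, 0) = 2 * R * (s - c) ∧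
    fderiv ℝ (P2f c s R) pPlus (0, 0, 1) = 0 ∧
    Matrix.det !![(0 : ℝ), 2 * R * s, 2;
                  2 * R * (c - s), 2 * R * (s + c), 0;
                  2 * R * (c + s), 2 * R * (s - c), 0] = -(16 * R ^ 2) ∧
    (-(16 * R ^ 2) : ℝ) ≠ 0 := by
  have hu : R * c * c + R * s * s = R := by linear_combination R * hcs
  have hv : R * c * s - R * s * c = 0 := by ring
  subst hp
  simp only [P2f_eq_P1f_neg, fderiv_F1f_apply, fderiv_P1f_apply, hu, hv]
  refine ⟨by ring, by ring, by ring, by ring, by ring, by ring, by ring, by ring, by ring, ?_,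
    neg_ne_zero.mpr (by positivity)⟩
  rw [Matrix.det_fin_three]
  simp
  linear_combination (-16 * R ^ 2) * hcs
end

section
/- Let c, s, R be real numbers with R > 0, and let q₊ = (R, 0, (1 + R²·s²)/2). Regard F₁(x,y,z) = y² − (x·s − y·c)² + 2z − 1, P₊(x,y,z) = x² + 2Ry − R², and P₋(x,y,z) = x² − 2Ry − R² as smooth functions on ℝ³. Then the gradients at q₊ are ∇F₁(q₊) = (−2Rs², 2Rsc, 2), ∇P₊(q₊) = (2R, 2R, 0), ∇P₋(q₊) = (2R, −2R, 0), and the determinant of the 3×3 matrix whose rows are these three gradients equals −16R² ≠ 0. In particular, the two quartic components of the k = 0 trisector are smooth at q₊ and cross transversely there, so q₊ is an ordinary real node. -/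
/-- The factor `P₊ = x² + 2Ry − R²` as a function on `ℝ³`. -/
def PplusF (R : ℝ) : ℝ × ℝ × ℝ → ℝ := fun p => p.1 ^ 2 + 2 * R * p.2.1 - R ^ 2

/-- The factor `P₋ = x² − 2Ry − R²` as a function on `ℝ³`. -/
def PminusF (R : ℝ) : ℝ × ℝ × ℝ → ℝ := fun p => p.1 ^ 2 - 2 * R * p.2.1 - R ^ 2

open ContinuousLinearMap in
theorem hasFDerivAt_F1f (c s : ℝ) (p : ℝ × ℝ × ℝ) :
    HasFDerivAt (F1f c s)
      ((-2 * s * (p.1 * s - p.2.1 * c)) • fst ℝ ℝ (ℝ × ℝ) +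
        (2 * p.2.1 + 2 * c * (p.1 * s - p.2.1 * c)) • (fst ℝ ℝ ℝ).comp (snd ℝ ℝ (ℝ × ℝ)) +
        (2 : ℝ) • (snd ℝ ℝ ℝ).comp (snd ℝ ℝ (ℝ × ℝ))) p := by
  have hx : HasFDerivAt (fun q : ℝ × ℝ × ℝ => q.1) (fst ℝ ℝ (ℝ × ℝ)) p := hasFDerivAt_fst
  have hy : HasFDerivAt (fun q : ℝ × ℝ × ℝ => q.2.1)
      ((fst ℝ ℝ ℝ).comp (snd ℝ ℝ (ℝ × ℝ))) p := hasFDerivAt_snd.fst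
  have hz : HasFDerivAt (fun q : ℝ × ℝ × ℝ => q.2.2)
      ((snd ℝ ℝ ℝ).comp (snd ℝ ℝ (ℝ × ℝ))) p := hasFDerivAt_snd.snd
  refine ((((hy.pow 2).sub (((hx.mul_const s).sub (hy.mul_const c)).pow 2)).add
    (hz.const_mul 2)).sub_const 1).congr_fderiv ?_
  refine ContinuousLinearMap.ext fun v => ?_
  simp
  ring

open ContinuousLinearMap in
theorem hasFDerivAt_PplusF (R : ℝ) (p : ℝ × ℝ × ℝ) :
    HasFDerivAt (PplusF R)
      ((2 * p.1) • fst ℝ ℝ (ℝ × ℝ) + (2 * R) • (fst ℝ ℝ ℝ).comp (snd ℝ ℝ (ℝ × ℝ))) p := by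
  have hx : HasFDerivAt (fun q : ℝ × ℝ × ℝ => q.1) (fst ℝ ℝ (ℝ × ℝ)) p := hasFDerivAt_fst
  have hy : HasFDerivAt (fun q : ℝ × ℝ × ℝ => q.2.1)
      ((fst ℝ ℝ ℝ).comp (snd ℝ ℝ (ℝ × ℝ))) p := hasFDerivAt_snd.fst
  refine (((hx.pow 2).add (hy.const_mul (2 * R))).sub_const (R ^ 2)).congr_fderiv ?_
  refine ContinuousLinearMap.ext fun v => ?_
  simp

theorem PminusF_eq_PplusF_neg (R : ℝ) : PminusF R = PplusF (-R) := by
  funext p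
  simp only [PminusF, PplusF]
  ring

/-- At the point `q₊ = (R, 0, (1 + R²s²)/2)` the gradients of `F₁, P₊, P₋` are
`(−2Rs², 2Rsc, 2)`, `(2R, 2R, 0)`, `(2R, −2R, 0)` respectively, and the determinant of
the 3×3 matrix with these rows equals `−16R² ≠ 0`. In particular the two quartic
components of the `k = 0` trisector are smooth at `q₊` and cross transversely there, so
`q₊` is an ordinary real node. -/
theorem k_eq_zero_node_transversality (c s R : ℝ) (hR : 0 < R)
    (qPlus : ℝ × ℝ × ℝ) (hq : qPlus = (R, 0, (1 + R ^ 2 * s ^ 2) / 2)) :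
    fderiv ℝ (F1f c s) qPlus (1, 0, 0) = -(2 * R * s ^ 2) ∧
    fderiv ℝ (F1f c s) qPlus (0, 1, 0) = 2 * R * s * c ∧
    fderiv ℝ (F1f c s) qPlus (0, 0, 1) = 2 ∧
    fderiv ℝ (PplusF R) qPlus (1, 0, 0) = 2 * R ∧
    fderiv ℝ (PplusF R) qPlus (0, 1, 0) = 2 * R ∧
    fderiv ℝ (PplusF R) qPlus (0, 0, 1) = 0 ∧
    fderiv ℝ (PminusF R) qPlus (1, 0, 0) = 2 * R ∧
    fderiv ℝ (PminusF R) qPlus (0, 1, 0) = -(2 * R) ∧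
    fderiv ℝ (PminusF R) qPlus (0, 0, 1) = 0 ∧
    Matrix.det !![-(2 * R * s ^ 2), 2 * R * s * c, 2;
                  2 * R, 2 * R, 0;
                  2 * R, -(2 * R), 0] = -(16 * R ^ 2) ∧
    (-(16 * R ^ 2) : ℝ) ≠ 0 := by
  subst hq
  rw [PminusF_eq_PplusF_neg, (hasFDerivAt_F1f c s _).fderiv, (hasFDerivAt_PplusF R _).fderiv,
    (hasFDerivAt_PplusF (-R) _).fderiv]
  refine ⟨?_, ?_, ?_, ?_, ?_, ?_, ?_, ?_, ?_, ?_, neg_ne_zero.2 (by positivity)⟩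
  case refine_10 =>
    rw [Matrix.det_fin_three]
    simp
    ring
  all_goals
    simp
  all_goals
    ring
end
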